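/- Suppose the m×N complex matrix Φ has restricted isometry constant δ_r = δ_r(Φ). Let T be a set of indices and x ∈ ℂ^N a vector such that r ≥ |T ∪ supp(x)|. Then ‖Φ_T* Φ (x|_{T^c})‖₂ ≤ δ_r · ‖x|_{T^c}‖₂. -/

import Mathlib

open Matrix
open scoped BigOperators Classical

/-- The Euclidean (ℓ₂) norm of a finitely indexed complex vector. -/
noncomputable def l2 {ι : Type*} [Fintype ι] (x : ι → ℂ) : ℝ :=
  Real.sqrt (∑ i, ‖x i‖ ^ 2)

/-- The ℓ₁ norm of a finitely indexed complex vector. -/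
noncomputable def l1 {ι : Type*} [Fintype ι] (x : ι → ℂ) : ℝ := ∑ i, ‖x i‖

/-- The ℓ∞ (supremum) norm of a finitely indexed complex vector. -/
noncomputable def linf {ι : Type*} [Fintype ι] (x : ι → ℂ) : ℝ := ⨆ i, ‖x i‖

/-- The support of a vector, as a finite set of coordinates. -/
noncomputable def suppF {N : ℕ} (x : Fin N → ℂ) : Finset (Fin N) :=
  Finset.univ.filter fun i => x i ≠ 0

/-- A vector is `s`-sparse when it has at most `s` nonzero entries. -/
def Sparse {N : ℕ} (s : ℕ) (x : Fin N → ℂ) : Prop := (suppF x).card ≤ s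

/-- Restriction of a vector to a set `T` of coordinates: equal to `x` on `T`, zero off `T`. -/
noncomputable def restrictTo {N : ℕ} (x : Fin N → ℂ) (T : Finset (Fin N)) : Fin N → ℂ :=
  fun i => if i ∈ T then x i else 0

/-- `y` is a best `s`-sparse approximation of `x`: it agrees with `x` on a set of `s`
coordinates of largest magnitude and vanishes elsewhere. -/
def IsSparseApprox {N : ℕ} (s : ℕ) (x y : Fin N → ℂ) : Prop :=
  ∃ T : Finset (Fin N), T.card = min s N ∧ y = restrictTo x T ∧
    ∀ i ∈ T, ∀ j ∉ T, ‖x j‖ ≤ ‖x i‖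

/-- The `r`-th restricted isometry constant of `Φ`: the least `δ ≥ 0` such that
`(1-δ)‖x‖² ≤ ‖Φx‖² ≤ (1+δ)‖x‖²` for all `r`-sparse `x`. -/
noncomputable def RIC {m N : ℕ} (Φ : Matrix (Fin m) (Fin N) ℂ) (r : ℕ) : ℝ :=
  sInf {δ : ℝ | 0 ≤ δ ∧ ∀ x : Fin N → ℂ, Sparse r x →
    (1 - δ) * l2 x ^ 2 ≤ l2 (Φ.mulVec x) ^ 2 ∧ l2 (Φ.mulVec x) ^ 2 ≤ (1 + δ) * l2 x ^ 2}

/-- The column submatrix of `Φ` with columns indexed by the finite set `T`. -/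
noncomputable def colSub {m N : ℕ} (Φ : Matrix (Fin m) (Fin N) ℂ) (T : Finset (Fin N)) :
    Matrix (Fin m) {i // i ∈ T} ℂ :=
  Matrix.of fun r c => Φ r c.1

/-- The least-squares estimate `Φ_T† u = (Φ_T* Φ_T)⁻¹ Φ_T* u`, viewed as a vector in `ℂ^N`
supported on `T`. -/
noncomputable def pinvApply {m N : ℕ} (Φ : Matrix (Fin m) (Fin N) ℂ) (T : Finset (Fin N))
    (u : Fin m → ℂ) : Fin N → ℂ :=
  fun j =>
    if h : j ∈ T then (((colSub Φ T)ᴴ * colSub Φ T)⁻¹ * (colSub Φ T)ᴴ).mulVec u ⟨j, h⟩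
    else 0

/-- One iteration of CoSaMP with samples `u` and sparsity level `s`, mapping the current
approximation `a` to the next approximation `a'`. -/
def CoSaMPStep {m N : ℕ} (Φ : Matrix (Fin m) (Fin N) ℂ) (u : Fin m → ℂ) (s : ℕ)
    (a a' : Fin N → ℂ) : Prop :=
  ∃ y2s : Fin N → ℂ,
    IsSparseApprox (2 * s) (Φᴴ.mulVec (u - Φ.mulVec a)) y2s ∧
    IsSparseApprox s (pinvApply Φ (suppF y2s ∪ suppF a) u) a'

/-- `a` is a sequence of approximations produced by CoSaMP: `a 0 = 0` and each successive
approximation arises from one CoSaMP iteration. -/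
def CoSaMPSeq {m N : ℕ} (Φ : Matrix (Fin m) (Fin N) ℂ) (u : Fin m → ℂ) (s : ℕ)
    (a : ℕ → Fin N → ℂ) : Prop :=
  a 0 = 0 ∧ ∀ k, CoSaMPStep Φ u s (a k) (a (k + 1))

/-- The spectral norm (ℓ₂ → ℓ₂ operator norm) of a matrix. -/
noncomputable def specNorm {a b : Type*} [Fintype a] [Fintype b] (M : Matrix a b ℂ) : ℝ :=
  sSup ((fun x => l2 (M.mulVec x)) '' {x | l2 x ≤ 1})

theorem l2_sq {ι : Type*} [Fintype ι] (x : ι → ℂ) : l2 x ^ 2 = ∑ i, ‖x i‖ ^ 2 :=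
  Real.sq_sqrt (Finset.sum_nonneg fun _ _ => sq_nonneg _)

theorem l2_nonneg {ι : Type*} [Fintype ι] (x : ι → ℂ) : 0 ≤ l2 x := Real.sqrt_nonneg _

theorem l2_eq_norm {ι : Type*} [Fintype ι] (x : ι → ℂ) : l2 x = ‖WithLp.toLp 2 x‖ := by
  simp [l2, EuclideanSpace.norm_eq]

theorem star_dotProduct_self_re {ι : Type*} [Fintype ι] (x : ι → ℂ) :
    (star x ⬝ᵥ x).re = l2 x ^ 2 := by
  simp [l2_sq, dotProduct, Complex.sq_norm, Complex.normSq_apply]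

theorem l2_add_real_smul_sq {ι : Type*} [Fintype ι] (u w : ι → ℂ) (s : ℝ) :
    l2 (u + (s : ℂ) • w) ^ 2 = l2 u ^ 2 + 2 * s * (star u ⬝ᵥ w).re + s ^ 2 * l2 w ^ 2 := by
  simp only [l2_sq, dotProduct, Complex.re_sum, Finset.mul_sum, ← Finset.sum_add_distrib]
  refine Finset.sum_congr rfl fun i _ => ?_
  simp [Complex.sq_norm, Complex.normSq_apply]
  ring

/-- The set whose infimum defines `RIC` is nonempty, because `Φ` is bounded. -/
theorem RIC_set_nonempty {m N : ℕ} (Φ : Matrix (Fin m) (Fin N) ℂ) (r : ℕ) :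
    {δ : ℝ | 0 ≤ δ ∧ ∀ x : Fin N → ℂ, Sparse r x →
      (1 - δ) * l2 x ^ 2 ≤ l2 (Φ.mulVec x) ^ 2 ∧
        l2 (Φ.mulVec x) ^ 2 ≤ (1 + δ) * l2 x ^ 2}.Nonempty := by
  set C := ‖(Matrix.toEuclideanLin Φ).toContinuousLinearMap‖
  refine ⟨1 + C ^ 2, by positivity, fun x _ => ?_⟩
  have h : l2 (Φ.mulVec x) ≤ C * l2 x := by
    simpa [l2_eq_norm, Matrix.toLpLin_toLp] using
      (Matrix.toEuclideanLin Φ).toContinuousLinearMap.le_opNorm (WithLp.toLp 2 x)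
  have h' := pow_le_pow_left₀ (l2_nonneg _) h 2
  constructor <;> nlinarith [sq_nonneg (l2 x), sq_nonneg (l2 (Φ.mulVec x)), sq_nonneg (C * l2 x)]

theorem sq_star_dotProduct_mulVec_le {m N : ℕ} {Φ : Matrix (Fin m) (Fin N) ℂ} {r : ℕ} {δ : ℝ}
    (hδ : ∀ x : Fin N → ℂ, Sparse r x →
      (1 - δ) * l2 x ^ 2 ≤ l2 (Φ.mulVec x) ^ 2 ∧ l2 (Φ.mulVec x) ^ 2 ≤ (1 + δ) * l2 x ^ 2)
    {v w : Fin N → ℂ} (hvw : star v ⬝ᵥ w = 0) (hr : (suppF v ∪ suppF w).card ≤ r) :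
    (star (Φ.mulVec v) ⬝ᵥ Φ.mulVec w).re ^ 2 ≤ δ ^ 2 * l2 v ^ 2 * l2 w ^ 2 := by
  have sparse (s : ℝ) : Sparse r (v + (s : ℂ) • w) := by
    refine (Finset.card_le_card fun i hi => ?_).trans hr
    simp only [suppF, Finset.mem_union, Finset.mem_filter, Finset.mem_univ, true_and] at hi ⊢
    contrapose! hi
    simp [hi]
  have quad (s : ℝ) : 0 ≤ (δ * l2 w ^ 2) * (s * s) +
      (-(2 * (star (Φ.mulVec v) ⬝ᵥ Φ.mulVec w).re)) * s + δ * l2 v ^ 2 := by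
    have h₁ := (hδ _ (sparse s)).2
    have h₂ := (hδ _ (sparse (-s))).1
    simp only [Matrix.mulVec_add, Matrix.mulVec_smul, l2_add_real_smul_sq, hvw,
      Complex.zero_re] at h₁ h₂
    linarith
  have := discrim_le_zero quad
  rw [discrim] at this
  linarith

/-- **Cross-correlation bound.**  If `r ≥ |T ∪ supp(x)|`, then
`‖Φ_T* Φ (x|_{T^c})‖₂ ≤ δ_r(Φ) · ‖x|_{T^c}‖₂`. -/
theorem cross_correlation
    {m N : ℕ} (r : ℕ) (Φ : Matrix (Fin m) (Fin N) ℂ)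
    (T : Finset (Fin N)) (x : Fin N → ℂ) (hr : (T ∪ suppF x).card ≤ r) :
    l2 ((colSub Φ T)ᴴ.mulVec (Φ.mulVec (restrictTo x Tᶜ))) ≤
      RIC Φ r * l2 (restrictTo x Tᶜ) := by
  set w := restrictTo x Tᶜ
  set v := restrictTo (Φᴴ.mulVec (Φ.mulVec w)) T
  have hl : l2 ((colSub Φ T)ᴴ.mulVec (Φ.mulVec w)) = l2 v := by
    rw [l2, l2]
    congr 1
    calc ∑ i, ‖(colSub Φ T)ᴴ.mulVec (Φ.mulVec w) i‖ ^ 2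
        = ∑ i : {i // i ∈ T}, ‖Φᴴ.mulVec (Φ.mulVec w) i‖ ^ 2 := rfl
      _ = ∑ i ∈ T, ‖Φᴴ.mulVec (Φ.mulVec w) i‖ ^ 2 :=
        Finset.sum_coe_sort T fun i => ‖Φᴴ.mulVec (Φ.mulVec w) i‖ ^ 2
      _ = ∑ i, ‖v i‖ ^ 2 := by
        simp [v, restrictTo, apply_ite, Finset.sum_ite_mem]
  have hvw : star v ⬝ᵥ w = 0 := by
    refine Finset.sum_eq_zero fun i _ => ?_
    by_cases hi : i ∈ T <;> simp [v, w, restrictTo, hi]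
  have hinner : (star (Φ.mulVec v) ⬝ᵥ Φ.mulVec w).re = l2 v ^ 2 := by
    rw [Matrix.star_mulVec, ← Matrix.dotProduct_mulVec, ← star_dotProduct_self_re]
    congr 1
    refine Finset.sum_congr rfl fun i _ => ?_
    by_cases hi : i ∈ T <;> simp [v, restrictTo, hi]
  have hcard : (suppF v ∪ suppF w).card ≤ r := by
    refine (Finset.card_le_card fun i hi => ?_).trans hr
    by_cases hT : i ∈ T
    · exact Finset.mem_union_left _ hT
    · simpa [suppF, v, w, restrictTo, hT] using hi
  have bound {δ : ℝ} (hδ : 0 ≤ δ ∧ ∀ x : Fin N → ℂ, Sparse r x →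
      (1 - δ) * l2 x ^ 2 ≤ l2 (Φ.mulVec x) ^ 2 ∧
        l2 (Φ.mulVec x) ^ 2 ≤ (1 + δ) * l2 x ^ 2) : l2 v ≤ δ * l2 w := by
    have h := sq_star_dotProduct_mulVec_le hδ.2 hvw hcard
    rw [hinner] at h
    rcases (l2_nonneg v).eq_or_lt with hv | hv
    · exact hv ▸ mul_nonneg hδ.1 (l2_nonneg w)
    · refine (sq_le_sq₀ hv.le (mul_nonneg hδ.1 (l2_nonneg w))).1 ?_
      refine le_of_mul_le_mul_left ?_ (pow_pos hv 2)
      linarith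
  rw [hl]
  rcases (l2_nonneg w).eq_or_lt with hw | hw
  · obtain ⟨δ, hδ⟩ := RIC_set_nonempty Φ r
    simpa [← hw] using bound hδ
  · rw [← div_le_iff₀ hw]
    exact le_csInf (RIC_set_nonempty Φ r) fun δ hδ => (div_le_iff₀ hw).2 (bound hδ)
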